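/- Let k be a natural number, p a natural number with p ≥ R_k, and G a finite simple graph. Let v_0 be a vertex of G, let V_1 = N(v_0) be the set of neighbors of v_0, V_2 = V(G) \ V_1, and let W_1 = { u ∈ V_1 : |N(u) ∩ V_2| ≥ p }. If |W_1| > (p−1)^{p+1}, then G contains a k-edge induced subgraph. -/

import Mathlib

/-- `G` contains a `k`-edge induced subgraph: there is a nonempty set `S` of vertices
such that the number of edges of `G` with both endpoints in `S` is exactly `k`. -/
def HasKEdgeInducedSubgraph {V : Type*} (G : SimpleGraph V) (k : ℕ) : Prop :=
  ∃ S : Finset V, S.Nonempty ∧ {e ∈ G.edgeSet | ∀ v ∈ e, v ∈ S}.ncard = k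

/-- The Ramsey number `R_k`: the least `N` such that every finite simple graph on at least `N`
vertices contains a clique of size `k` or an independent set of size `k`. -/
noncomputable def ramseyNumber (k : ℕ) : ℕ :=
  sInf {N : ℕ | ∀ (V : Type) (inst : Fintype V) (G : SimpleGraph V),
    N ≤ @Fintype.card V inst →
    (∃ S : Finset V, S.card = k ∧ ∀ u ∈ S, ∀ w ∈ S, u ≠ w → G.Adj u w) ∨
    (∃ S : Finset V, S.card = k ∧ ∀ u ∈ S, ∀ w ∈ S, u ≠ w → ¬ G.Adj u w)}

open Finset

/-- Ramsey's theorem for cliques of size `a` and independent sets of size `b`, inside a finite set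
of vertices. -/
theorem exists_ramsey_bound (a b : ℕ) : ∃ N : ℕ, ∀ (V : Type) (G : SimpleGraph V) (A : Finset V),
    N ≤ A.card →
    (∃ S ⊆ A, S.card = a ∧ ∀ u ∈ S, ∀ w ∈ S, u ≠ w → G.Adj u w) ∨
    (∃ S ⊆ A, S.card = b ∧ ∀ u ∈ S, ∀ w ∈ S, u ≠ w → ¬ G.Adj u w) := by
  classical
  induction a generalizing b with
  | zero => exact ⟨0, fun V G A _ => Or.inl ⟨∅, by simp⟩⟩
  | succ a iha =>
    induction b with
    | zero => exact ⟨0, fun V G A _ => Or.inr ⟨∅, by simp⟩⟩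
    | succ b ihb =>
      obtain ⟨M, hM⟩ := iha (b + 1)
      obtain ⟨N, hN⟩ := ihb
      refine ⟨M + N + 1, fun V G A hA => ?_⟩
      obtain ⟨v, hv⟩ : A.Nonempty := card_pos.mp (by omega)
      have hsplit := card_filter_add_card_filter_not (s := A.erase v) (fun w => G.Adj v w)
      rw [card_erase_of_mem hv] at hsplit
      rcases le_or_gt M ((A.erase v).filter fun w => G.Adj v w).card with h | h
      · rcases hM V G _ h with ⟨S, hS, hc, hadj⟩ | ⟨S, hS, hc, hadj⟩
        · have hS' : ∀ w ∈ S, (w ≠ v ∧ w ∈ A) ∧ G.Adj v w := fun w hw => by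
            simpa using hS hw
          refine Or.inl ⟨insert v S, ?_, ?_, ?_⟩
          · exact insert_subset hv fun w hw => (hS' w hw).1.2
          · rw [card_insert_of_notMem fun hvS => (hS' v hvS).1.1 rfl, hc]
          · intro u hu w hw huw
            rcases mem_insert.mp hu with rfl | hu' <;> rcases mem_insert.mp hw with rfl | hw'
            · exact absurd rfl huw
            · exact (hS' w hw').2
            · exact (hS' u hu').2.symm
            · exact hadj u hu' w hw' huw
        · exact Or.inr ⟨S, hS.trans ((filter_subset _ _).trans (erase_subset _ _)), hc, hadj⟩
      · have h' : N ≤ ((A.erase v).filter fun w => ¬ G.Adj v w).card := by omega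
        rcases hN V G _ h' with ⟨S, hS, hc, hadj⟩ | ⟨S, hS, hc, hadj⟩
        · exact Or.inl ⟨S, hS.trans ((filter_subset _ _).trans (erase_subset _ _)), hc, hadj⟩
        · have hS' : ∀ w ∈ S, (w ≠ v ∧ w ∈ A) ∧ ¬ G.Adj v w := fun w hw => by
            simpa using hS hw
          refine Or.inr ⟨insert v S, ?_, ?_, ?_⟩
          · exact insert_subset hv fun w hw => (hS' w hw).1.2
          · rw [card_insert_of_notMem fun hvS => (hS' v hvS).1.1 rfl, hc]
          · intro u hu w hw huw
            rcases mem_insert.mp hu with rfl | hu' <;> rcases mem_insert.mp hw with rfl | hw'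
            · exact absurd rfl huw
            · exact (hS' w hw').2
            · exact fun h => (hS' u hu').2 h.symm
            · exact hadj u hu' w hw' huw

theorem ramseyNumber_spec (k : ℕ) (V : Type) (inst : Fintype V) (G : SimpleGraph V)
    (h : ramseyNumber k ≤ @Fintype.card V inst) :
    (∃ S : Finset V, S.card = k ∧ ∀ u ∈ S, ∀ w ∈ S, u ≠ w → G.Adj u w) ∨
    (∃ S : Finset V, S.card = k ∧ ∀ u ∈ S, ∀ w ∈ S, u ≠ w → ¬ G.Adj u w) := by
  obtain ⟨N, hN⟩ := exists_ramsey_bound k k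
  refine Nat.sInf_mem (s := {N : ℕ | ∀ (V : Type) (inst : Fintype V) (G : SimpleGraph V),
    N ≤ @Fintype.card V inst →
    (∃ S : Finset V, S.card = k ∧ ∀ u ∈ S, ∀ w ∈ S, u ≠ w → G.Adj u w) ∨
    (∃ S : Finset V, S.card = k ∧ ∀ u ∈ S, ∀ w ∈ S, u ≠ w → ¬ G.Adj u w)})
    ⟨N, fun V inst G hV => ?_⟩ V inst G h
  rcases hN V G univ hV with ⟨S, -, hS⟩ | ⟨S, -, hS⟩
  exacts [Or.inl ⟨S, hS⟩, Or.inr ⟨S, hS⟩]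

theorem exists_clique_or_indep_of_ramseyNumber_le {V : Type*} (G : SimpleGraph V) {k : ℕ}
    (A : Finset V) (hA : ramseyNumber k ≤ A.card) :
    (∃ S ⊆ A, S.card = k ∧ ∀ u ∈ S, ∀ w ∈ S, u ≠ w → G.Adj u w) ∨
    (∃ S ⊆ A, S.card = k ∧ ∀ u ∈ S, ∀ w ∈ S, u ≠ w → ¬ G.Adj u w) := by
  let φ : Fin A.card ↪ V := A.equivFin.symm.toEmbedding.trans (Function.Embedding.subtype _)
  have hφ (S : Finset (Fin A.card)) : S.map φ ⊆ A := by
    intro x hx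
    obtain ⟨i, -, rfl⟩ := mem_map.mp hx
    exact (A.equivFin.symm i).2
  rcases ramseyNumber_spec k (Fin A.card) inferInstance (G.comap φ) (by simpa using hA) with
    ⟨S, hc, hS⟩ | ⟨S, hc, hS⟩
  · refine Or.inl ⟨S.map φ, hφ S, by simpa using hc, ?_⟩
    simp only [mem_map]
    rintro _ ⟨i, hi, rfl⟩ _ ⟨j, hj, rfl⟩ hij
    exact hS i hi j hj (fun h => hij (congrArg φ h))
  · refine Or.inr ⟨S.map φ, hφ S, by simpa using hc, ?_⟩
    simp only [mem_map]
    rintro _ ⟨i, hi, rfl⟩ _ ⟨j, hj, rfl⟩ hij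
    exact hS i hi j hj (fun h => hij (congrArg φ h))

/-- If `n` dominates the degrees into `X` of a large set `W`, then there is either an induced
matching of size greater than `q` between `W` and `X`, or a complete bipartite pair. -/
theorem exists_induced_matching_or_biclique {α β : Type*} [DecidableEq β]
    (r : α → β → Prop) [∀ a b, Decidable (r a b)] (q n : ℕ) (W : Finset α) (X : Finset β)
    (hW : q ^ (n + 1) < W.card) (hX : ∀ w ∈ W, n ≤ (X.filter (r w)).card) :
    (∃ Y ⊆ X, ∃ f : β → α, q < Y.card ∧ ∀ x ∈ Y, f x ∈ W ∧ ∀ y ∈ Y, r (f x) y ↔ x = y) ∨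
    (∃ D ⊆ X, ∃ U ⊆ W, D.card = n ∧ q < U.card ∧ ∀ u ∈ U, ∀ d ∈ D, r u d) := by
  induction n generalizing W X with
  | zero => exact Or.inr ⟨∅, by simp, W, Subset.rfl, by simp, by simpa using hW, by simp⟩
  | succ n ih =>
    have hdom : ∃ Y ⊆ X, ∀ w ∈ W, ∃ y ∈ Y, r w y := ⟨X, Subset.rfl, fun w hw => by
      obtain ⟨y, hy⟩ := card_pos.mp (lt_of_lt_of_le n.succ_pos (hX w hw))
      exact ⟨y, (mem_filter.mp hy).1, (mem_filter.mp hy).2⟩⟩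
    obtain ⟨Y, ⟨hYX, hY⟩, hmin⟩ :=
      WellFounded.has_min (measure (Finset.card : Finset β → ℕ)).wf
        {Y | Y ⊆ X ∧ ∀ w ∈ W, ∃ y ∈ Y, r w y} hdom
    rcases lt_or_ge q Y.card with hq | hq
    · left
      have hpriv : ∀ x ∈ Y, ∃ w ∈ W, ∀ y ∈ Y, r w y ↔ x = y := by
        intro x hx
        have hnot : ¬ ∀ w ∈ W, ∃ y ∈ Y.erase x, r w y := fun h =>
          hmin (Y.erase x) ⟨(erase_subset _ _).trans hYX, h⟩ (card_erase_lt_of_mem hx)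
        push Not at hnot
        obtain ⟨w, hw, hwy⟩ := hnot
        have hne : ∀ y ∈ Y, r w y → x = y := fun y hy hr => by
          by_contra hxy
          exact hwy y (mem_erase.mpr ⟨Ne.symm hxy, hy⟩) hr
        refine ⟨w, hw, fun y hy => ⟨hne y hy, ?_⟩⟩
        rintro rfl
        obtain ⟨z, hz, hr⟩ := hY w hw
        rwa [hne z hz hr]
      have : Nonempty α := by
        obtain ⟨w, -⟩ := card_pos.mp (lt_of_le_of_lt (Nat.zero_le _) hW)
        exact ⟨w⟩
      choose! f hf using hpriv
      exact ⟨Y, hYX, f, hq, hf⟩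
    · obtain ⟨x, hx, hlt⟩ : ∃ x ∈ Y, q ^ (n + 1) < (W.filter fun w => r w x).card := by
        classical
        by_contra! hle
        have hcov : W ⊆ Y.biUnion fun x => W.filter fun w => r w x := fun w hw => by
          obtain ⟨y, hy, hr⟩ := hY w hw
          exact mem_biUnion.mpr ⟨y, hy, mem_filter.mpr ⟨hw, hr⟩⟩
        have h1 := (card_le_card hcov).trans (card_biUnion_le_card_mul _ _ _ hle)
        have h2 : Y.card * q ^ (n + 1) ≤ q ^ (n + 1 + 1) := by
          rw [pow_succ' q (n + 1)]
          exact Nat.mul_le_mul_right _ hq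
        omega
      have hdeg : ∀ w ∈ W.filter (fun w => r w x), n ≤ ((X.erase x).filter (r w)).card := by
        intro w hw
        obtain ⟨hw, hr⟩ := mem_filter.mp hw
        have := hX w hw
        rw [filter_erase, card_erase_of_mem (mem_filter.mpr ⟨hYX hx, hr⟩)]
        omega
      rcases ih _ _ hlt hdeg with ⟨Z, hZ, f, hq, hf⟩ | ⟨D, hD, U, hU, hDc, hUc, hr⟩
      · exact Or.inl ⟨Z, hZ.trans (erase_subset _ _), f, hq,
          fun z hz => ⟨(mem_filter.mp (hf z hz).1).1, (hf z hz).2⟩⟩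
      · refine Or.inr ⟨insert x D, insert_subset (hYX hx) (hD.trans (erase_subset _ _)), U,
          hU.trans (filter_subset _ _), ?_, hUc, ?_⟩
        · rw [card_insert_of_notMem fun h => (mem_erase.mp (hD h)).1 rfl, hDc]
        · intro u hu d hd
          rcases mem_insert.mp hd with rfl | hd
          · exact (mem_filter.mp (hU hu)).2
          · exact hr u hu d hd

section EdgeCount

variable {V : Type*} [Fintype V] [DecidableEq V] (G : SimpleGraph V) [DecidableRel G.Adj]

/-- The number of edges of `G` with both endpoints in `S`. -/
def inducedEdgeCount (S : Finset V) : ℕ :=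
  (G.edgeFinset.filter fun e => ∀ v ∈ e, v ∈ S).card

theorem hasKEdgeInducedSubgraph_of_inducedEdgeCount_eq {k : ℕ} (S : Finset V) (hS : S.Nonempty)
    (h : inducedEdgeCount G S = k) : HasKEdgeInducedSubgraph G k := by
  refine ⟨S, hS, ?_⟩
  rw [← h, inducedEdgeCount, ← Set.ncard_coe_finset]
  congr 1
  ext e
  simp

theorem inducedEdgeCount_empty : inducedEdgeCount G ∅ = 0 := by
  rw [inducedEdgeCount, card_eq_zero, filter_eq_empty_iff]
  intro e _ h
  induction e with
  | _ a b => simpa using h a (by simp)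

theorem inducedEdgeCount_insert {v : V} {S : Finset V} (hv : v ∉ S) :
    inducedEdgeCount G (insert v S) = inducedEdgeCount G S + (S.filter (G.Adj v)).card := by
  have hunion : (G.edgeFinset.filter fun e => ∀ x ∈ e, x ∈ insert v S) =
      (G.edgeFinset.filter fun e => ∀ x ∈ e, x ∈ S) ∪
        (S.filter (G.Adj v)).image fun w => s(v, w) := by
    ext e
    induction e with
    | _ a b =>
      simp only [mem_filter, SimpleGraph.mem_edgeFinset, SimpleGraph.mem_edgeSet, Sym2.mem_iff,
        forall_eq_or_imp, forall_eq, mem_insert, mem_union, mem_image, Sym2.eq_iff]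
      constructor
      · rintro ⟨hab, rfl | ha, rfl | hb⟩
        · exact absurd rfl hab.ne
        · exact Or.inr ⟨b, ⟨hb, hab⟩, Or.inl ⟨rfl, rfl⟩⟩
        · exact Or.inr ⟨a, ⟨ha, hab.symm⟩, Or.inr ⟨rfl, rfl⟩⟩
        · exact Or.inl ⟨hab, ha, hb⟩
      · rintro (⟨hab, ha, hb⟩ | ⟨w, ⟨hw, hvw⟩, ⟨rfl, rfl⟩ | ⟨rfl, rfl⟩⟩)
        · exact ⟨hab, Or.inr ha, Or.inr hb⟩
        · exact ⟨hvw, Or.inl rfl, Or.inr hw⟩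
        · exact ⟨hvw.symm, Or.inr hw, Or.inl rfl⟩
  rw [inducedEdgeCount, hunion, card_union_of_disjoint, card_image_of_injective, inducedEdgeCount]
  · intro a b hab
    exact Sym2.congr_right.mp hab
  · rw [disjoint_left]
    intro e he he'
    obtain ⟨w, -, rfl⟩ := mem_image.mp he'
    exact hv ((mem_filter.mp he).2 v (by simp))

theorem inducedEdgeCount_union {S T : Finset V} (h : Disjoint S T) :
    inducedEdgeCount G (S ∪ T) = inducedEdgeCount G S + inducedEdgeCount G T +
      ∑ s ∈ S, (T.filter (G.Adj s)).card := by
  induction S using Finset.induction_on with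
  | empty => simp [inducedEdgeCount_empty]
  | insert v S hv ih =>
    obtain ⟨hvT, hST⟩ := disjoint_insert_left.mp h
    rw [insert_union, inducedEdgeCount_insert G (by simp [hv, hvT]), ih hST,
      inducedEdgeCount_insert G hv, sum_insert hv, filter_union,
      card_union_of_disjoint (disjoint_filter_filter hST)]
    omega

theorem inducedEdgeCount_clique {S : Finset V}
    (h : ∀ u ∈ S, ∀ w ∈ S, u ≠ w → G.Adj u w) : inducedEdgeCount G S = S.card.choose 2 := by
  induction S using Finset.induction_on with
  | empty => simp [inducedEdgeCount_empty]
  | insert v S hv ih =>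
    have hchoose : (S.card + 1).choose 2 = S.card + S.card.choose 2 := by
      rw [Nat.choose_succ_succ', Nat.choose_one_right]
    rw [inducedEdgeCount_insert G hv, card_insert_of_notMem hv, hchoose,
      ih fun u hu w hw => h u (mem_insert_of_mem hu) w (mem_insert_of_mem hw),
      filter_true_of_mem fun w hw => h v (mem_insert_self _ _) w (mem_insert_of_mem hw)
        (by rintro rfl; exact hv hw), add_comm]

theorem inducedEdgeCount_indep {S : Finset V}
    (h : ∀ u ∈ S, ∀ w ∈ S, u ≠ w → ¬ G.Adj u w) : inducedEdgeCount G S = 0 := by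
  rw [inducedEdgeCount, card_eq_zero, filter_eq_empty_iff]
  intro e he h'
  induction e with
  | _ a b =>
    have hab : G.Adj a b := by simpa using he
    exact h a (h' a (by simp)) b (h' b (by simp)) hab.ne hab

/-- A set `A` of at least `R_k` common neighbors of a vertex contains a clique of size `k`, unless
`G` has an induced star with `k` edges. -/
theorem exists_clique_of_subset_neighborFinset {k : ℕ} {v : V} {A : Finset V}
    (hA : ramseyNumber k ≤ A.card) (hv : ∀ w ∈ A, G.Adj v w)
    (hG : ¬ HasKEdgeInducedSubgraph G k) :
    ∃ S ⊆ A, S.card = k ∧ ∀ u ∈ S, ∀ w ∈ S, u ≠ w → G.Adj u w := by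
  rcases exists_clique_or_indep_of_ramseyNumber_le G A hA with h | ⟨S, hS, hc, hind⟩
  · exact h
  · refine absurd (hasKEdgeInducedSubgraph_of_inducedEdgeCount_eq G (insert v S)
      (insert_nonempty _ _) ?_) hG
    rw [inducedEdgeCount_insert G fun h => (hv v (hS h)).ne rfl, inducedEdgeCount_indep G hind,
      filter_true_of_mem fun w hw => hv w (hS hw), hc, zero_add]

theorem exists_subset_inducedEdgeCount_le (D : Finset V) (r : ℕ) (hr : r ≤ D.card) :
    ∃ B ⊆ D, B.card ≤ r ∧ inducedEdgeCount G B ≤ r ∧ r ≤ inducedEdgeCount G B + B.card := by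
  induction r with
  | zero => exact ⟨∅, by simp, by simp, by simp [inducedEdgeCount_empty], by simp⟩
  | succ r ih =>
    obtain ⟨B, hBD, hB, he, hle⟩ := ih (by omega)
    rcases hle.lt_or_eq with hlt | heq
    · exact ⟨B, hBD, by omega, by omega, hlt⟩
    · obtain ⟨d, hd, hdB⟩ := exists_mem_notMem_of_card_lt_card (show B.card < D.card by omega)
      have h1 := inducedEdgeCount_insert G hdB
      have h2 := card_insert_of_notMem hdB
      have h3 := card_filter_le B (G.Adj d)
      exact ⟨insert d B, insert_subset hd hBD, by omega, by omega, by omega⟩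

end EdgeCount

theorem exists_eq_choose_two_add {k : ℕ} (hk : 0 < k) :
    ∃ t r : ℕ, k = t.choose 2 + r ∧ 0 < r ∧ r ≤ t ∧ t ≤ t.choose 2 + 1 := by
  induction k, hk using Nat.le_induction with
  | base => exact ⟨1, 1, by decide⟩
  | succ k _ ih =>
    obtain ⟨t, r, hk, hr, hrt, ht⟩ := ih
    rcases hrt.lt_or_eq with hlt | rfl
    · exact ⟨t, r + 1, by omega, by omega, by omega, ht⟩
    · have h : (r + 1).choose 2 = r + r.choose 2 := by
        rw [Nat.choose_succ_succ', Nat.choose_one_right]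
      exact ⟨r + 1, 1, by omega, by omega, by omega, by omega⟩

section Configurations

variable {V : Type*} [Fintype V] [DecidableEq V] (G : SimpleGraph V) [DecidableRel G.Adj]

theorem hasKEdgeInducedSubgraph_of_matching {k : ℕ} (hk : 0 < k) {v0 : V} {D : Finset V}
    (f : V → V) (hD : D.card = k) (hv0 : ∀ d ∈ D, d ≠ v0 ∧ ¬ G.Adj v0 d)
    (hf : ∀ d ∈ D, G.Adj v0 (f d)) (hm : ∀ d ∈ D, ∀ d' ∈ D, G.Adj (f d) d' ↔ d = d')
    (hclique : ∀ d ∈ D, ∀ d' ∈ D, d ≠ d' → G.Adj (f d) (f d')) :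
    HasKEdgeInducedSubgraph G k := by
  obtain ⟨t, r, hktr, hr, hrt, ht⟩ := exists_eq_choose_two_add hk
  obtain ⟨B, hBD, hB, he, hle⟩ := exists_subset_inducedEdgeCount_le G D r (by omega)
  have hinj : Set.InjOn f D := fun d hd d' hd' h => by
    by_contra hne
    exact (hclique d hd d' hd' hne).ne h
  obtain ⟨B₁, hB₁, hc₁⟩ :=
    exists_subset_card_eq (show r - inducedEdgeCount G B ≤ B.card by omega)
  have hv0im : v0 ∉ (D \ B).image f := fun h => by
    obtain ⟨d, hd, h⟩ := mem_image.mp h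
    exact (hf d (mem_sdiff.mp hd).1).ne h.symm
  have hcard : (insert v0 ((D \ B).image f)).card = k + 1 - B.card := by
    have hBk := card_le_card hBD
    rw [card_insert_of_notMem hv0im, card_image_of_injOn, card_sdiff_of_subset hBD, hD]
    · omega
    · exact hinj.mono (by simp)
  obtain ⟨T₂, hT₂, hc₂⟩ := exists_subset_card_eq
    (show t - (r - inducedEdgeCount G B) ≤ (insert v0 ((D \ B).image f)).card by omega)
  have hT₂' : ∀ x ∈ T₂, x = v0 ∨ ∃ d ∈ D, d ∉ B ∧ f d = x := fun x hx => by
    simpa [and_assoc] using hT₂ hx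
  have hT₁' : ∀ x ∈ B₁.image f, ∃ d ∈ D, d ∈ B ∧ f d = x := fun x hx => by
    obtain ⟨d, hd, rfl⟩ := mem_image.mp hx
    exact ⟨d, hBD (hB₁ hd), hB₁ hd, rfl⟩
  have hcT₁ : (B₁.image f).card = r - inducedEdgeCount G B := by
    rw [card_image_of_injOn (hinj.mono (coe_subset.mpr (hB₁.trans hBD))), hc₁]
  have hdisj : Disjoint (B₁.image f) T₂ := by
    rw [disjoint_left]
    intro x hx hx'
    obtain ⟨d, hd, hdB, rfl⟩ := hT₁' x hx
    rcases hT₂' _ hx' with h | ⟨d', hd', hdB', h⟩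
    · exact (hf d hd).ne h.symm
    · exact hdB' (hinj hd' hd h ▸ hdB)
  have hT : ∀ x ∈ B₁.image f ∪ T₂, x = v0 ∨ ∃ d ∈ D, f d = x := by
    intro x hx
    rcases mem_union.mp hx with hx | hx
    · obtain ⟨d, hd, -, h⟩ := hT₁' x hx
      exact Or.inr ⟨d, hd, h⟩
    · rcases hT₂' x hx with h | ⟨d, hd, -, h⟩
      exacts [Or.inl h, Or.inr ⟨d, hd, h⟩]
  have hTB : Disjoint (B₁.image f ∪ T₂) B := by
    rw [disjoint_left]
    intro x hx hxB
    rcases hT x hx with rfl | ⟨d, hd, rfl⟩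
    · exact (hv0 x (hBD hxB)).1 rfl
    · exact (hv0 _ (hBD hxB)).2 (hf d hd)
  have hTclique : ∀ x ∈ B₁.image f ∪ T₂, ∀ y ∈ B₁.image f ∪ T₂, x ≠ y → G.Adj x y := by
    intro x hx y hy hxy
    rcases hT x hx with rfl | ⟨d, hd, rfl⟩ <;> rcases hT y hy with rfl | ⟨d', hd', rfl⟩
    · exact absurd rfl hxy
    · exact hf d' hd'
    · exact (hf d hd).symm
    · exact hclique d hd d' hd' (by rintro rfl; exact hxy rfl)
  have hsum₁ : ∑ x ∈ B₁.image f, (B.filter (G.Adj x)).card = r - inducedEdgeCount G B := by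
    rw [← hcT₁, card_eq_sum_ones]
    refine sum_congr rfl fun x hx => ?_
    obtain ⟨d, hd, hdB, rfl⟩ := hT₁' x hx
    rw [card_eq_one]
    refine ⟨d, ?_⟩
    ext y
    simp only [mem_filter, mem_singleton]
    constructor
    · rintro ⟨hy, h⟩
      exact ((hm d hd y (hBD hy)).mp h).symm
    · rintro rfl
      exact ⟨hdB, (hm y hd y hd).mpr rfl⟩
  have hsum₂ : ∑ x ∈ T₂, (B.filter (G.Adj x)).card = 0 := by
    refine sum_eq_zero fun x hx => ?_
    rw [card_eq_zero, filter_eq_empty_iff]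
    intro y hy
    rcases hT₂' x hx with rfl | ⟨d, hd, hdB, rfl⟩
    · exact (hv0 y (hBD hy)).2
    · rw [hm d hd y (hBD hy)]
      rintro rfl
      exact hdB hy
  have hcount : inducedEdgeCount G ((B₁.image f ∪ T₂) ∪ B) = k := by
    rw [inducedEdgeCount_union G hTB, inducedEdgeCount_clique G hTclique, sum_union hdisj, hsum₁,
      hsum₂, card_union_of_disjoint hdisj, hcT₁, hc₂,
      show r - inducedEdgeCount G B + (t - (r - inducedEdgeCount G B)) = t by omega]
    omega
  refine hasKEdgeInducedSubgraph_of_inducedEdgeCount_eq G _ ?_ hcount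
  rw [nonempty_iff_ne_empty]
  intro h
  rw [h, inducedEdgeCount_empty] at hcount
  omega

theorem hasKEdgeInducedSubgraph_of_joined_cliques {k : ℕ} (hk : 0 < k) {v0 : V} {P Q : Finset V}
    (hP : P.card = k) (hQ : Q.card = k) (hv0P : ∀ x ∈ P, x ≠ v0 ∧ ¬ G.Adj v0 x)
    (hv0Q : ∀ x ∈ Q, G.Adj v0 x) (hPc : ∀ u ∈ P, ∀ w ∈ P, u ≠ w → G.Adj u w)
    (hQc : ∀ u ∈ Q, ∀ w ∈ Q, u ≠ w → G.Adj u w) (hQP : ∀ u ∈ Q, ∀ w ∈ P, G.Adj u w) :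
    HasKEdgeInducedSubgraph G k := by
  obtain ⟨t, r, hktr, hr, hrt, ht⟩ := exists_eq_choose_two_add hk
  obtain ⟨P', hP', hcP⟩ := exists_subset_card_eq (show t - r ≤ P.card by omega)
  obtain ⟨Q', hQ', hcQ⟩ := exists_subset_card_eq (show r ≤ Q.card by omega)
  have hdisj : Disjoint P' Q' := by
    rw [disjoint_left]
    exact fun x hx hx' => (hv0P x (hP' hx)).2 (hv0Q x (hQ' hx'))
  have hv0 : v0 ∉ P' ∪ Q' := fun h => by
    rcases mem_union.mp h with h | h
    · exact (hv0P _ (hP' h)).1 rfl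
    · exact (hv0Q _ (hQ' h)).ne rfl
  have hclique : ∀ x ∈ P' ∪ Q', ∀ y ∈ P' ∪ Q', x ≠ y → G.Adj x y := by
    intro x hx y hy hxy
    rcases mem_union.mp hx with hx | hx <;> rcases mem_union.mp hy with hy | hy
    · exact hPc x (hP' hx) y (hP' hy) hxy
    · exact (hQP y (hQ' hy) x (hP' hx)).symm
    · exact hQP x (hQ' hx) y (hP' hy)
    · exact hQc x (hQ' hx) y (hQ' hy) hxy
  refine hasKEdgeInducedSubgraph_of_inducedEdgeCount_eq G (insert v0 (P' ∪ Q'))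
    (insert_nonempty _ _) ?_
  rw [inducedEdgeCount_insert G hv0, inducedEdgeCount_clique G hclique, filter_union,
    filter_false_of_mem fun x hx => (hv0P x (hP' hx)).2,
    filter_true_of_mem fun x hx => hv0Q x (hQ' hx), empty_union, card_union_of_disjoint hdisj,
    hcP, hcQ, Nat.sub_add_cancel hrt, hktr]

end Configurations

theorem claim1_large_W1 {V : Type*} [Fintype V] [DecidableEq V] (G : SimpleGraph V)
    [DecidableRel G.Adj] (k p : ℕ) (hp : ramseyNumber k ≤ p) (v0 : V)
    (hW1 : (p - 1) ^ (p + 1) <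
      ((G.neighborFinset v0).filter fun u =>
        p ≤ (G.neighborFinset u ∩ (Finset.univ \ G.neighborFinset v0)).card).card) :
    HasKEdgeInducedSubgraph G k := by
  by_contra hG
  set W := (G.neighborFinset v0).filter fun u =>
    p ≤ (G.neighborFinset u ∩ (Finset.univ \ G.neighborFinset v0)).card
  have hWv0 : ∀ w ∈ W, G.Adj v0 w := fun w hw => by
    simpa using (mem_filter.mp hw).1
  have hk : 0 < k := by
    rw [Nat.pos_iff_ne_zero]
    rintro rfl
    exact hG (hasKEdgeInducedSubgraph_of_inducedEdgeCount_eq G {v0} (singleton_nonempty _)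
      (inducedEdgeCount_indep G (by simp)))
  have hk1 : k ≠ 1 := by
    rintro rfl
    obtain ⟨w, hw⟩ := card_pos.mp (lt_of_le_of_lt (Nat.zero_le _) hW1)
    have hadj := hWv0 w hw
    refine hG (hasKEdgeInducedSubgraph_of_inducedEdgeCount_eq G {v0, w} (insert_nonempty _ _) ?_)
    rw [inducedEdgeCount_clique G, card_pair hadj.ne, Nat.choose_self]
    simp [hadj, hadj.symm]
  have hp0 : 0 < p := by
    rw [Nat.pos_iff_ne_zero]
    rintro rfl
    obtain ⟨S, hS, hc, -⟩ := exists_clique_of_subset_neighborFinset G (v := v0) (A := ∅)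
      (by simpa using hp) (by simp) hG
    rw [subset_empty.mp hS, card_empty] at hc
    omega
  set X := (univ \ G.neighborFinset v0).erase v0 with hX
  have hXv0 : ∀ x ∈ X, x ≠ v0 ∧ ¬ G.Adj v0 x := fun x hx => by
    simpa [hX] using hx
  have hdeg : ∀ w ∈ W, p - 1 ≤ (X.filter (G.Adj w)).card := by
    intro w hw
    have hle := (mem_filter.mp hw).2
    have heq : X.filter (G.Adj w) =
        (G.neighborFinset w ∩ (univ \ G.neighborFinset v0)).erase v0 := by
      ext x
      simp [hX]
      tauto
    have := pred_card_le_card_erase (s := G.neighborFinset w ∩ (univ \ G.neighborFinset v0))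
      (a := v0)
    rw [heq]
    omega
  have hlarge : (p - 1) ^ (p - 1 + 1) < W.card := by
    refine lt_of_le_of_lt ?_ hW1
    rcases Nat.eq_zero_or_pos (p - 1) with h | h
    · simp [h]
    · exact Nat.pow_le_pow_right h (by omega)
  rcases exists_induced_matching_or_biclique G.Adj (p - 1) (p - 1) W X hlarge hdeg with
    ⟨Y, hYX, f, hY, hf⟩ | ⟨D, hDX, U, hUW, hD, hU, hadj⟩
  · have hinj : Set.InjOn f Y := fun x hx y hy h => by
      rw [← (hf x hx).2 y hy, h]
      exact ((hf y hy).2 y hy).mpr rfl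
    have himage : ∀ u ∈ Y.image f, G.Adj v0 u := fun u hu => by
      obtain ⟨y, hy, rfl⟩ := mem_image.mp hu
      exact hWv0 _ (hf y hy).1
    obtain ⟨S, hS, hSc, hclique⟩ := exists_clique_of_subset_neighborFinset G (A := Y.image f)
      (by rw [card_image_of_injOn hinj]; omega) himage hG
    obtain ⟨D, hDY, rfl⟩ := subset_image_iff.mp hS
    have hDinj : Set.InjOn f D := hinj.mono hDY
    rw [card_image_of_injOn hDinj] at hSc
    exact hG (hasKEdgeInducedSubgraph_of_matching G hk f hSc (fun d hd => hXv0 d (hYX (hDY hd)))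
      (fun d hd => hWv0 _ (hf d (hDY hd)).1) (fun d hd d' hd' => (hf d (hDY hd)).2 d' (hDY hd'))
      (fun d hd d' hd' hne => hclique _ (mem_image_of_mem f hd) _ (mem_image_of_mem f hd')
        fun h => hne (hDinj hd hd' h)))
  · obtain ⟨Q, hQU, hQ, hQc⟩ := exists_clique_of_subset_neighborFinset G (A := U) (by omega)
      (fun u hu => hWv0 u (hUW hu)) hG
    obtain ⟨u, hu⟩ := card_pos.mp (lt_of_le_of_lt (Nat.zero_le _) hU)
    have hv0D : v0 ∉ D := fun h => (hXv0 v0 (hDX h)).1 rfl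
    have hu' : ∀ w ∈ insert v0 D, G.Adj u w := fun w hw => by
      rcases mem_insert.mp hw with rfl | hw
      · exact (hWv0 u (hUW hu)).symm
      · exact hadj u hu w hw
    obtain ⟨P, hPD, hP, hPc⟩ := exists_clique_of_subset_neighborFinset G (A := insert v0 D)
      (by rw [card_insert_of_notMem hv0D]; omega) hu' hG
    have hv0P : v0 ∉ P := fun h => by
      obtain ⟨x, hx, hne⟩ := exists_mem_ne (show 1 < P.card by omega) v0
      have hxD : x ∈ D := (mem_insert.mp (hPD hx)).resolve_left hne
      exact (hXv0 x (hDX hxD)).2 (hPc v0 h x hx hne.symm)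
    have hPD' : ∀ x ∈ P, x ∈ D := fun x hx =>
      (mem_insert.mp (hPD hx)).resolve_left (by rintro rfl; exact hv0P hx)
    exact hG (hasKEdgeInducedSubgraph_of_joined_cliques G hk hP hQ
      (fun x hx => hXv0 x (hDX (hPD' x hx))) (fun x hx => hWv0 x (hUW (hQU hx))) hPc hQc
      (fun u hu w hw => hadj u (hQU hu) w (hPD' w hw)))
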